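/- arXiv:1811.11881 — 4 statements merged into one kernel-verified Lean document; each statement's English description precedes it below -/
import Mathlib

section
/- Let K ≥ 1, d ≥ 1, r ∈ [0,1]^K, c_1,…,c_d ∈ [0,1]^K and 0 < B ≤ T. Assume there is a dummy resource i₀ with c_{i₀}(a) = B/T for every arm a, and a null arm a₀ with r(a₀) = 0 and c_i(a₀) = 0 for every resource i ≠ i₀. Then max_{X ∈ Δ_K} min_{λ ∈ Δ_d} L(X, λ) = min_{λ ∈ Δ_d} max_{X ∈ Δ_K} L(X, λ) = OPT_LP(r, c; B, T); that is, the minimax value of the Lagrangian zero-sum game (with the dual player restricted to distributions over resources) equals the LP value. -/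
open Finset

/-- LP value `OPT_LP(r, c; B, T)`: maximum of `r·X` over probability vectors `X ∈ Δ_K`
satisfying `c_i·X ≤ B/T` for every resource `i`. -/
noncomputable def optLP (K d : ℕ) (r : Fin K → ℝ) (c : Fin d → Fin K → ℝ) (B T : ℝ) : ℝ :=
  sSup {v : ℝ | ∃ X ∈ stdSimplex ℝ (Fin K),
    (∀ i : Fin d, ∑ a, c i a * X a ≤ B / T) ∧ v = ∑ a, r a * X a}

/-- Lagrange function `L(X, λ) = r·X + Σ_i λ_i (1 − (T/B) c_i·X)`. -/
noncomputable def lagrange (K d : ℕ) (r : Fin K → ℝ) (c : Fin d → Fin K → ℝ) (B T : ℝ)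
    (X : Fin K → ℝ) (lam : Fin d → ℝ) : ℝ :=
  (∑ a, r a * X a) + ∑ i, lam i * (1 - (T / B) * ∑ a, c i a * X a)

theorem lagr_cont (K d : ℕ) (r : Fin K → ℝ) (c : Fin d → Fin K → ℝ) (B T : ℝ) :
    Continuous (fun p : (Fin K → ℝ) × (Fin d → ℝ) => lagrange K d r c B T p.1 p.2) := by
  unfold lagrange
  fun_prop

theorem lagr_comb_left (K d : ℕ) (r : Fin K → ℝ) (c : Fin d → Fin K → ℝ) (B T : ℝ)
    (X Y : Fin K → ℝ) (l : Fin d → ℝ) (a b : ℝ) (hab : a + b = 1) :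
    lagrange K d r c B T (a • X + b • Y) l =
      a * lagrange K d r c B T X l + b * lagrange K d r c B T Y l := by
  unfold lagrange
  have h : ∀ f : Fin K → ℝ, ∑ k, f k * (a • X + b • Y) k
      = a * ∑ k, f k * X k + b * ∑ k, f k * Y k := by
    intro f
    rw [Finset.mul_sum, Finset.mul_sum, ← Finset.sum_add_distrib]
    refine Finset.sum_congr rfl fun k _ => ?_
    simp only [Pi.add_apply, Pi.smul_apply, smul_eq_mul]
    ring
  have h2 : ∑ i, l i * (1 - (T / B) * ∑ k, c i k * (a • X + b • Y) k)
      = a * ∑ i, l i * (1 - (T / B) * ∑ k, c i k * X k)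
        + b * ∑ i, l i * (1 - (T / B) * ∑ k, c i k * Y k) := by
    rw [Finset.mul_sum, Finset.mul_sum, ← Finset.sum_add_distrib]
    refine Finset.sum_congr rfl fun i _ => ?_
    rw [h]
    obtain rfl : b = 1 - a := by linarith
    ring
  rw [h, h2]
  ring

theorem lagr_comb_right (K d : ℕ) (r : Fin K → ℝ) (c : Fin d → Fin K → ℝ) (B T : ℝ)
    (X : Fin K → ℝ) (l m : Fin d → ℝ) (a b : ℝ) (hab : a + b = 1) :
    lagrange K d r c B T X (a • l + b • m) =
      a * lagrange K d r c B T X l + b * lagrange K d r c B T X m := by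
  unfold lagrange
  have h2 : ∀ f : Fin d → ℝ, ∑ i, (a • l + b • m) i * f i
      = a * ∑ i, l i * f i + b * ∑ i, m i * f i := by
    intro f
    rw [Finset.mul_sum, Finset.mul_sum, ← Finset.sum_add_distrib]
    refine Finset.sum_congr rfl fun i _ => ?_
    simp only [Pi.add_apply, Pi.smul_apply, smul_eq_mul]
    ring
  rw [h2]
  obtain rfl : b = 1 - a := by linarith
  ring

theorem lagr_saddle (K d : ℕ) (r : Fin K → ℝ) (c : Fin d → Fin K → ℝ) (B T : ℝ)
    (i₀ : Fin d) (a₀ : Fin K) :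
    ∃ l ∈ stdSimplex ℝ (Fin d), ∃ X ∈ stdSimplex ℝ (Fin K),
      ∀ l' ∈ stdSimplex ℝ (Fin d), ∀ X' ∈ stdSimplex ℝ (Fin K),
        lagrange K d r c B T X' l ≤ lagrange K d r c B T X l' := by
  have hc := lagr_cont K d r c B T
  have h := Sion.exists_isSaddlePointOn (X := stdSimplex ℝ (Fin d)) (Y := stdSimplex ℝ (Fin K))
    (f := fun l X => lagrange K d r c B T X l)
    ⟨_, single_mem_stdSimplex ℝ i₀⟩ (convex_stdSimplex ℝ _) (isCompact_stdSimplex ℝ (Fin d))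
    (fun X _ => ((hc.comp (by fun_prop : Continuous fun l => (X, l))).continuousOn).lowerSemicontinuousOn)
    (fun X _ => ConvexOn.quasiconvexOn ⟨convex_stdSimplex ℝ _, fun l _ m _ a b _ _ hab => by
      simp only [lagr_comb_right K d r c B T X l m a b hab, smul_eq_mul, le_refl]⟩)
    (convex_stdSimplex ℝ _)
    ⟨_, single_mem_stdSimplex ℝ a₀⟩ (isCompact_stdSimplex ℝ (Fin K))
    (fun l _ => ((hc.comp (by fun_prop : Continuous fun X => (X, l))).continuousOn).upperSemicontinuousOn)
    (fun l _ => ConcaveOn.quasiconcaveOn ⟨convex_stdSimplex ℝ _, fun X _ Y _ a b _ _ hab => by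
      simp only [lagr_comb_left K d r c B T X Y l a b hab, smul_eq_mul, le_refl]⟩)
  exact h

theorem lagr_round (K d : ℕ) (r : Fin K → ℝ) (c : Fin d → Fin K → ℝ)
    (hr : ∀ a, r a ∈ Set.Icc (0:ℝ) 1)
    (B T : ℝ) (hB : 0 < B) (hBT : B ≤ T)
    (i₀ : Fin d) (hdummy : ∀ a, c i₀ a = B / T)
    (a₀ : Fin K) (hnullr : r a₀ = 0) (hnullc : ∀ i, i ≠ i₀ → c i a₀ = 0)
    (X : Fin K → ℝ) (hX : X ∈ stdSimplex ℝ (Fin K)) :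
    ∃ l ∈ stdSimplex ℝ (Fin d), ∃ Y ∈ stdSimplex ℝ (Fin K),
      (∀ i, ∑ a, c i a * Y a ≤ B / T) ∧ lagrange K d r c B T X l ≤ ∑ a, r a * Y a := by
  have hT : 0 < T := lt_of_lt_of_le hB hBT
  have : Nonempty (Fin d) := ⟨i₀⟩
  obtain ⟨j, hj⟩ := Finite.exists_max (fun i => (T / B) * ∑ a, c i a * X a)
  have hdum : ∀ Y ∈ stdSimplex ℝ (Fin K), ∑ a, c i₀ a * Y a = B / T := by
    intro Y hY
    simp_rw [hdummy]
    rw [← Finset.mul_sum, hY.2, mul_one]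
  set m := (T / B) * ∑ a, c j a * X a with hm
  have hm1 : 1 ≤ m := by
    have := hj i₀
    simp only [hdum X hX] at this
    have h2 : T / B * (B / T) = 1 := by field_simp
    linarith
  have hm0 : 0 < m := by linarith
  have hinv : m⁻¹ ≤ 1 := inv_le_one_of_one_le₀ hm1
  have hinv0 : 0 < m⁻¹ := by positivity
  set Y : Fin K → ℝ := m⁻¹ • X + (1 - m⁻¹) • Pi.single a₀ 1 with hYdef
  have hY : Y ∈ stdSimplex ℝ (Fin K) :=
    convex_stdSimplex ℝ (Fin K) hX (single_mem_stdSimplex ℝ a₀) hinv0.le (by linarith) (by ring)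
  have hsum : ∀ f : Fin K → ℝ, ∑ k, f k * Y k = m⁻¹ * ∑ k, f k * X k + (1 - m⁻¹) * f a₀ := by
    intro f
    have : f a₀ = ∑ k, f k * (Pi.single a₀ (1:ℝ) : Fin K → ℝ) k := by
      simp [Pi.single_apply]
    rw [this, Finset.mul_sum, Finset.mul_sum, ← Finset.sum_add_distrib]
    refine Finset.sum_congr rfl fun k _ => ?_
    simp only [hYdef, Pi.add_apply, Pi.smul_apply, smul_eq_mul]
    ring
  refine ⟨Pi.single j 1, single_mem_stdSimplex ℝ j, Y, hY, ?_, ?_⟩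
  · intro i
    by_cases hi : i = i₀
    · subst hi
      exact (hdum Y hY).le
    · rw [hsum, hnullc i hi]
      have h1 : (T / B) * ∑ a, c i a * X a ≤ m := hj i
      have h2 : ∑ a, c i a * X a = (B / T) * ((T / B) * ∑ a, c i a * X a) := by field_simp
      rw [h2]
      have h3 : (B / T) * ((T / B) * ∑ a, c i a * X a) ≤ (B / T) * m :=
        mul_le_mul_of_nonneg_left h1 (by positivity)
      have h4 := mul_le_mul_of_nonneg_left h3 hinv0.le
      have h5 : m⁻¹ * (B / T * m) = B / T := by field_simp
      linarith
  · rw [hsum, hnullr]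
    have hL : lagrange K d r c B T X (Pi.single j 1) = ∑ a, r a * X a + (1 - m) := by
      unfold lagrange
      simp [Pi.single_apply, hm]
    have hR : ∑ a, r a * X a ≤ 1 := by
      rw [← hX.2]
      refine Finset.sum_le_sum fun a _ => ?_
      have := mul_le_mul_of_nonneg_right (hr a).2 (hX.1 a)
      linarith
    rw [hL]
    have h6 : m⁻¹ * m = 1 := inv_mul_cancel₀ hm0.ne'
    nlinarith [mul_nonneg (sub_nonneg.2 hR) (sub_nonneg.2 hinv), mul_nonneg (sub_nonneg.2 hm1) (sub_nonneg.2 hinv)]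

theorem lagr_feas (K d : ℕ) (r : Fin K → ℝ) (c : Fin d → Fin K → ℝ)
    (B T : ℝ) (hB : 0 < B) (hT : 0 < T)
    (X : Fin K → ℝ) (hf : ∀ i, ∑ a, c i a * X a ≤ B / T)
    (l : Fin d → ℝ) (hl : l ∈ stdSimplex ℝ (Fin d)) :
    ∑ a, r a * X a ≤ lagrange K d r c B T X l := by
  unfold lagrange
  have : 0 ≤ ∑ i, l i * (1 - (T / B) * ∑ a, c i a * X a) := by
    refine Finset.sum_nonneg fun i _ => mul_nonneg (hl.1 i) ?_
    have h1 := mul_le_mul_of_nonneg_left (hf i) (by positivity : 0 ≤ T / B)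
    have h2 : T / B * (B / T) = 1 := by field_simp
    linarith
  linarith

/-- The minimax value of the Lagrangian zero-sum game (dual player restricted to
distributions over resources) equals the LP value:
`max_X min_λ L = min_λ max_X L = OPT_LP`. -/
theorem minimax_lagrangian_eq_optLP
    (K d : ℕ) (hK : 1 ≤ K) (hd : 1 ≤ d)
    (r : Fin K → ℝ) (c : Fin d → Fin K → ℝ)
    (hr : ∀ a, r a ∈ Set.Icc (0:ℝ) 1) (hc : ∀ i a, c i a ∈ Set.Icc (0:ℝ) 1)
    (B T : ℝ) (hB : 0 < B) (hBT : B ≤ T)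
    (i₀ : Fin d) (hdummy : ∀ a, c i₀ a = B / T)
    (a₀ : Fin K) (hnullr : r a₀ = 0) (hnullc : ∀ i, i ≠ i₀ → c i a₀ = 0) :
    sSup {v : ℝ | ∃ X ∈ stdSimplex ℝ (Fin K),
        v = sInf {w : ℝ | ∃ lam ∈ stdSimplex ℝ (Fin d), w = lagrange K d r c B T X lam}}
      = optLP K d r c B T
    ∧ sInf {w : ℝ | ∃ lam ∈ stdSimplex ℝ (Fin d),
        w = sSup {v : ℝ | ∃ X ∈ stdSimplex ℝ (Fin K), v = lagrange K d r c B T X lam}}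
      = optLP K d r c B T := by
  have hT : 0 < T := lt_of_lt_of_le hB hBT
  obtain ⟨l, hl, X, hX, hs⟩ := lagr_saddle K d r c B T i₀ a₀
  have hcont := lagr_cont K d r c B T
  obtain ⟨l', hl', Y, hY, hYf, hYv⟩ :=
    lagr_round K d r c hr B T hB hBT i₀ hdummy a₀ hnullr hnullc X hX
  have hopt : optLP K d r c B T = lagrange K d r c B T X l := by
    unfold optLP
    refine IsGreatest.csSup_eq ⟨⟨Y, hY, hYf, ?_⟩, ?_⟩
    · exact le_antisymm ((hs l' hl' X hX).trans hYv)
        ((lagr_feas K d r c B T hB hT Y hYf l hl).trans (hs l hl Y hY))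
    · rintro v ⟨Z, hZ, hZf, rfl⟩
      exact (lagr_feas K d r c B T hB hT Z hZf l hl).trans (hs l hl Z hZ)
  rw [hopt]
  constructor
  · refine IsGreatest.csSup_eq ⟨⟨X, hX, ?_⟩, ?_⟩
    · symm
      apply IsLeast.csInf_eq
      refine ⟨⟨l, hl, rfl⟩, ?_⟩
      rintro w ⟨m, hm, rfl⟩
      exact hs m hm X hX
    · rintro v ⟨Z, hZ, rfl⟩
      refine le_trans (csInf_le ?_ ?_) (hs l hl Z hZ)
      swap
      · exact ⟨l, hl, rfl⟩
      have := ((isCompact_stdSimplex ℝ (Fin d)).image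
        (hcont.comp (by fun_prop : Continuous fun l => (Z, l)))).bddBelow
      refine this.mono ?_
      rintro w ⟨m, hm, rfl⟩
      exact ⟨m, hm, rfl⟩
  · refine IsLeast.csInf_eq ⟨⟨l, hl, ?_⟩, ?_⟩
    · symm
      apply IsGreatest.csSup_eq
      refine ⟨⟨X, hX, rfl⟩, ?_⟩
      rintro w ⟨Z, hZ, rfl⟩
      exact hs l hl Z hZ
    · rintro v ⟨m, hm, rfl⟩
      refine (hs m hm X hX).trans (le_csSup ?_ ⟨X, hX, rfl⟩)
      have := ((isCompact_stdSimplex ℝ (Fin K)).image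
        (hcont.comp (by fun_prop : Continuous fun Z => (Z, m)))).bddAbove
      refine this.mono ?_
      rintro w ⟨Z, hZ, rfl⟩
      exact ⟨Z, hZ, rfl⟩
end

section
/- Let K ≥ 1, d ≥ 1, r ∈ [0,1]^K, c_1,…,c_d ∈ [0,1]^K and 0 < B ≤ T. Assume there is a dummy resource i₀ with c_{i₀}(a) = B/T for every arm a, and a null arm a₀ with r(a₀) = 0 and c_i(a₀) = 0 for every resource i ≠ i₀. Suppose (X*, λ*) ∈ Δ_K × Δ_d is a mixed Nash equilibrium of the Lagrangian game, i.e., L(X, λ*) ≤ L(X*, λ*) ≤ L(X*, λ) for all X ∈ Δ_K and λ ∈ Δ_d. Then X* is an optimal solution of the linear program defining OPT_LP(r, c; B, T) (in particular X* is feasible), and L(X*, λ*) = OPT_LP(r, c; B, T). -/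
open Finset

/-- If `(X*, λ*)` is a mixed Nash equilibrium of the Lagrangian game, then `X*` is an
optimal (in particular feasible) solution of the LP, and `L(X*, λ*) = OPT_LP`. -/
theorem nash_equilibrium_gives_optimal_LP_solution
    (K d : ℕ) (hK : 1 ≤ K) (hd : 1 ≤ d)
    (r : Fin K → ℝ) (c : Fin d → Fin K → ℝ)
    (hr : ∀ a, r a ∈ Set.Icc (0:ℝ) 1) (hc : ∀ i a, c i a ∈ Set.Icc (0:ℝ) 1)
    (B T : ℝ) (hB : 0 < B) (hBT : B ≤ T)
    (i₀ : Fin d) (hdummy : ∀ a, c i₀ a = B / T)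
    (a₀ : Fin K) (hnullr : r a₀ = 0) (hnullc : ∀ i, i ≠ i₀ → c i a₀ = 0)
    (Xs : Fin K → ℝ) (lams : Fin d → ℝ)
    (hXs : Xs ∈ stdSimplex ℝ (Fin K)) (hlams : lams ∈ stdSimplex ℝ (Fin d))
    (hNash₁ : ∀ X ∈ stdSimplex ℝ (Fin K),
      lagrange K d r c B T X lams ≤ lagrange K d r c B T Xs lams)
    (hNash₂ : ∀ lam ∈ stdSimplex ℝ (Fin d),
      lagrange K d r c B T Xs lams ≤ lagrange K d r c B T Xs lam) :
    (∀ i : Fin d, ∑ a, c i a * Xs a ≤ B / T)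
    ∧ (∀ X ∈ stdSimplex ℝ (Fin K), (∀ i : Fin d, ∑ a, c i a * X a ≤ B / T) →
        ∑ a, r a * X a ≤ ∑ a, r a * Xs a)
    ∧ lagrange K d r c B T Xs lams = optLP K d r c B T := by
  have hT : 0 < T := lt_of_lt_of_le hB hBT
  have hTB : 0 < T / B := div_pos hT hB
  have hTBm : T / B * (B / T) = 1 := by field_simp
  obtain ⟨g, hg⟩ : ∃ g : Fin d → ℝ, ∀ i, g i = 1 - (T / B) * ∑ a, c i a * Xs a :=
    ⟨_, fun _ => rfl⟩
  have hL : ∀ lam, lagrange K d r c B T Xs lam = (∑ a, r a * Xs a) + ∑ i, lam i * g i := by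
    intro lam
    simp only [lagrange, hg]
  obtain ⟨m, hm⟩ : ∃ m : ℝ, m = ∑ i, lams i * g i := ⟨_, rfl⟩
  have hmj : ∀ j, m ≤ g j := by
    intro j
    have h := hNash₂ (Pi.single j 1) (single_mem_stdSimplex ℝ j)
    rw [hL, hL, ← hm] at h
    simp [Pi.single_apply] at h
    exact h
  have hg0 : g i₀ = 0 := by
    rw [hg]
    simp only [hdummy]
    rw [← Finset.mul_sum, hXs.2, mul_one, hTBm, sub_self]
  have hrX : ∑ a, r a * Xs a ≤ 1 := by
    rw [← hXs.2]
    exact Finset.sum_le_sum fun a _ => mul_le_of_le_one_left (hXs.1 a) (hr a).2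
  have hm0 : m = 0 := by
    by_contra hne
    have hneg : m < 0 := lt_of_le_of_ne (hg0 ▸ hmj i₀) hne
    have hsum : ∑ i, lams i * (g i - m) = 0 := by
      simp only [mul_sub, Finset.sum_sub_distrib, ← Finset.sum_mul]
      rw [hlams.2, ← hm]; ring
    have h1 : lams i₀ * (g i₀ - m) ≤ ∑ i, lams i * (g i - m) :=
      Finset.single_le_sum (f := fun i => lams i * (g i - m))
        (fun i _ => mul_nonneg (hlams.1 i) (sub_nonneg.2 (hmj i))) (Finset.mem_univ i₀)
    have h2 : lams i₀ = 0 := by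
      have := hlams.1 i₀
      rw [hsum, hg0] at h1
      nlinarith
    have h3 := hNash₁ (Pi.single a₀ 1) (single_mem_stdSimplex ℝ a₀)
    rw [hL, ← hm] at h3
    have h4 : lagrange K d r c B T (Pi.single a₀ 1) lams = 1 := by
      have : ∀ i, lams i * (1 - (T / B) * ∑ a, c i a * (Pi.single a₀ 1 : Fin K → ℝ) a)
          = lams i := by
        intro i
        by_cases hi : i = i₀
        · rw [hi, h2, zero_mul]
        · simp [Pi.single_apply, hnullc i hi]
      simp only [lagrange, this, hlams.2]
      simp [Pi.single_apply, hnullr]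
    linarith
  have hfeas : ∀ i : Fin d, ∑ a, c i a * Xs a ≤ B / T := by
    intro i
    have h := hmj i
    rw [hm0, hg, ← hTBm, ← mul_sub] at h
    linarith [nonneg_of_mul_nonneg_right h hTB]
  have hval : lagrange K d r c B T Xs lams = ∑ a, r a * Xs a := by
    rw [hL, ← hm, hm0, add_zero]
  have hopt : ∀ X ∈ stdSimplex ℝ (Fin K), (∀ i : Fin d, ∑ a, c i a * X a ≤ B / T) →
        ∑ a, r a * X a ≤ ∑ a, r a * Xs a := by
    intro X hX hf
    have h := hNash₁ X hX
    rw [hval] at h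
    refine le_trans ?_ h
    unfold lagrange
    refine le_add_of_nonneg_right (Finset.sum_nonneg fun i _ => mul_nonneg (hlams.1 i) ?_)
    have := mul_le_mul_of_nonneg_left (hf i) hTB.le
    linarith
  refine ⟨hfeas, hopt, ?_⟩
  rw [hval]
  symm
  refine IsGreatest.csSup_eq ⟨⟨Xs, hXs, hfeas, rfl⟩, ?_⟩
  rintro v ⟨X, hX, hf, rfl⟩
  exact hopt X hX hf
end

section
/- Let K ≥ 1, d ≥ 1, r ∈ [0,1]^K, c_1,…,c_d ∈ [0,1]^K and 0 < B ≤ T. Assume there is a dummy resource i₀ with c_{i₀}(a) = B/T for every arm a, and a null arm a₀ with r(a₀) = 0 and c_i(a₀) = 0 for every resource i ≠ i₀. Suppose (X*, λ*) ∈ Δ_K × Δ_d is a mixed Nash equilibrium of the Lagrangian game, i.e., L(X, λ*) ≤ L(X*, λ*) ≤ L(X*, λ) for all X ∈ Δ_K and λ ∈ Δ_d. Then for every resource i ∈ [d] one has 1 − (T/B)·(c_i·X*) ≥ 0; that is, X* satisfies every budget constraint c_i·X* ≤ B/T. -/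
open Finset

/-- At a mixed Nash equilibrium `(X*, λ*)` of the Lagrangian game, `X*` satisfies every
budget constraint: `1 − (T/B)(c_i·X*) ≥ 0`, i.e. `c_i·X* ≤ B/T`, for every resource `i`. -/
theorem nash_equilibrium_feasible
    (K d : ℕ) (hK : 1 ≤ K) (hd : 1 ≤ d)
    (r : Fin K → ℝ) (c : Fin d → Fin K → ℝ)
    (hr : ∀ a, r a ∈ Set.Icc (0:ℝ) 1) (hc : ∀ i a, c i a ∈ Set.Icc (0:ℝ) 1)
    (B T : ℝ) (hB : 0 < B) (hBT : B ≤ T)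
    (i₀ : Fin d) (hdummy : ∀ a, c i₀ a = B / T)
    (a₀ : Fin K) (hnullr : r a₀ = 0) (hnullc : ∀ i, i ≠ i₀ → c i a₀ = 0)
    (Xs : Fin K → ℝ) (lams : Fin d → ℝ)
    (hXs : Xs ∈ stdSimplex ℝ (Fin K)) (hlams : lams ∈ stdSimplex ℝ (Fin d))
    (hNash₁ : ∀ X ∈ stdSimplex ℝ (Fin K),
      lagrange K d r c B T X lams ≤ lagrange K d r c B T Xs lams)
    (hNash₂ : ∀ lam ∈ stdSimplex ℝ (Fin d),
      lagrange K d r c B T Xs lams ≤ lagrange K d r c B T Xs lam) :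
    ∀ i : Fin d, 0 ≤ 1 - (T / B) * ∑ a, c i a * Xs a := by
  intro j
  by_contra hneg
  push Not at hneg
  have hT : 0 < T := lt_of_lt_of_le hB hBT
  have hTB : T / B * (B / T) = 1 := by field_simp
  obtain ⟨hX0, hX1⟩ := hXs
  obtain ⟨hl0, hl1⟩ := hlams
  have hdum : ∀ X : Fin K → ℝ, ∑ a, X a = 1 → 1 - (T / B) * ∑ a, c i₀ a * X a = 0 := by
    intro X hX
    simp only [hdummy]
    rw [← Finset.mul_sum, hX, mul_one, hTB, sub_self]
  have hrX : ∑ a, r a * Xs a ≤ 1 := by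
    rw [← hX1]
    exact Finset.sum_le_sum fun a _ => mul_le_of_le_one_left (hX0 a) (hr a).2
  have hV : ∀ i, ∑ k, lams k * (1 - (T / B) * ∑ a, c k a * Xs a)
      ≤ 1 - (T / B) * ∑ a, c i a * Xs a := by
    intro i
    have h := hNash₂ (Pi.single i 1) (single_mem_stdSimplex ℝ i)
    simp only [lagrange] at h
    simpa [Pi.single_apply, ite_mul] using h
  have hN := hNash₁ (Pi.single a₀ 1) (single_mem_stdSimplex ℝ a₀)
  have hdum1 := hdum (Pi.single a₀ 1) (single_mem_stdSimplex ℝ a₀).2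
  have hdumX := hdum Xs hX1
  simp only [lagrange] at hN
  generalize hs : (fun i => 1 - (T / B) * ∑ a, c i a * Xs a) = s at *
  have hs' : ∀ i, 1 - (T / B) * ∑ a, c i a * Xs a = s i := fun i => by rw [← hs]
  simp only [hs'] at hN hV hneg hdumX
  set V := ∑ k, lams k * s k with hVdef
  have h0 : ∑ i, lams i * (s i - V) = 0 := by
    simp only [mul_sub, Finset.sum_sub_distrib]
    rw [← Finset.sum_mul, hl1, ← hVdef]; ring
  have h1 : lams i₀ * (s i₀ - V) ≤ 0 := by
    rw [← h0]
    exact Finset.single_le_sum (f := fun i => lams i * (s i - V))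
      (fun i _ => mul_nonneg (hl0 i) (sub_nonneg.2 (hV i))) (Finset.mem_univ i₀)
  have hVneg : V < 0 := lt_of_le_of_lt (hV j) hneg
  have hA : ∑ i, lams i * (1 - (T / B) * ∑ a, c i a * (Pi.single a₀ 1 : Fin K → ℝ) a)
      = 1 - lams i₀ := by
    have : ∀ i, lams i * (1 - (T / B) * ∑ a, c i a * (Pi.single a₀ 1 : Fin K → ℝ) a)
        = lams i - if i = i₀ then lams i else 0 := by
      intro i
      by_cases h : i = i₀
      · subst h
        rw [hdum1]; simp
      · simp [Pi.single_apply, hnullc i h, h]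
    rw [Finset.sum_congr rfl fun i _ => this i, Finset.sum_sub_distrib, hl1]
    simp
  have hR : ∑ a, r a * (Pi.single a₀ 1 : Fin K → ℝ) a = 0 := by
    simp [Pi.single_apply, hnullr]
  rw [hA, hR] at hN
  rw [hdumX] at h1
  nlinarith [hl0 i₀]
end

section
/- Let κ > 1, let d ≥ 1 be an integer, and let G_min > 0 and V ≥ G_min be real numbers. Define T₀(u) = G_min·κ^u/(d+1) for u ≥ 0, Λ(u) = min( T₀(u), max(0, V − d·T₀(u)) ), and u* = log_κ( (d+1)·V / (d·G_min) ). Then ∫_0^{u*} Λ(u) du ≥ (V − G_min) / ((d+1)·ln κ). -/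
/-- Integral lower bound for the randomized-guess algorithm for adversarial BwK:
with `T₀(u) = G_min·κ^u/(d+1)`, `Λ(u) = min(T₀(u), max(0, V − d·T₀(u)))` and
`u* = log_κ((d+1)·V/(d·G_min))`, one has
`∫_0^{u*} Λ(u) du ≥ (V − G_min)/((d+1)·ln κ)`. -/
theorem guess_integral_lower_bound
    (κ : ℝ) (hκ : 1 < κ) (d : ℕ) (hd : 1 ≤ d)
    (Gmin V : ℝ) (hG : 0 < Gmin) (hV : Gmin ≤ V) :
    (V - Gmin) / (((d : ℝ) + 1) * Real.log κ)
      ≤ ∫ u in (0:ℝ)..(Real.logb κ (((d : ℝ) + 1) * V / ((d : ℝ) * Gmin))),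
          min (Gmin * κ ^ u / ((d : ℝ) + 1))
            (max 0 (V - (d : ℝ) * (Gmin * κ ^ u / ((d : ℝ) + 1)))) := by
  have hκ0 : 0 < κ := by linarith
  have hlog : 0 < Real.log κ := Real.log_pos hκ
  have hd1 : (1 : ℝ) ≤ (d : ℝ) := by exact_mod_cast hd
  have hd0 : (0 : ℝ) < (d : ℝ) := by linarith
  have hdp : (0 : ℝ) < (d : ℝ) + 1 := by linarith
  have hV0 : 0 < V := by linarith
  have hcr : Continuous (fun u : ℝ => κ ^ u) :=
    Real.continuous_const_rpow hκ0.ne'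
  set f : ℝ → ℝ := fun u => min (Gmin * κ ^ u / ((d : ℝ) + 1))
            (max 0 (V - (d : ℝ) * (Gmin * κ ^ u / ((d : ℝ) + 1)))) with hf
  have hfc : Continuous f := by
    have hc : Continuous (fun u : ℝ => Gmin * κ ^ u / ((d : ℝ) + 1)) :=
      (continuous_const.mul hcr).div_const _
    exact hc.min (continuous_const.max (continuous_const.sub (continuous_const.mul hc)))
  have hf0 : ∀ u, 0 ≤ f u := by
    intro u
    have : 0 < κ ^ u := Real.rpow_pos_of_pos hκ0 u
    exact le_min (by positivity) (le_max_left _ _)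
  have hu1 : 0 ≤ Real.logb κ (V / Gmin) :=
    Real.logb_nonneg hκ ((one_le_div hG).2 hV)
  have hu2 : Real.logb κ (V / Gmin) ≤
      Real.logb κ (((d : ℝ) + 1) * V / ((d : ℝ) * Gmin)) := by
    apply Real.logb_le_logb_of_le hκ (by positivity)
    rw [div_le_div_iff₀ hG (by positivity)]
    nlinarith [mul_pos hV0 hG]
  rw [← intervalIntegral.integral_add_adjacent_intervals
    (hfc.intervalIntegrable 0 (Real.logb κ (V / Gmin))) (hfc.intervalIntegrable _ _)]
  have h2 : 0 ≤ ∫ u in (Real.logb κ (V / Gmin))..(Real.logb κ (((d : ℝ) + 1) * V / ((d : ℝ) * Gmin))), f u :=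
    intervalIntegral.integral_nonneg hu2 (fun u _ => hf0 u)
  have hpow : κ ^ Real.logb κ (V / Gmin) = V / Gmin :=
    Real.rpow_logb hκ0 hκ.ne' (by positivity)
  have h1 : ∫ u in (0:ℝ)..(Real.logb κ (V / Gmin)), f u
      = (V - Gmin) / (((d : ℝ) + 1) * Real.log κ) := by
    have e : ∫ u in (0:ℝ)..(Real.logb κ (V / Gmin)), f u
        = ∫ u in (0:ℝ)..(Real.logb κ (V / Gmin)), Gmin * κ ^ u / ((d : ℝ) + 1) := by
      apply intervalIntegral.integral_congr
      intro u hu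
      rw [Set.uIcc_of_le hu1] at hu
      have hk : κ ^ u ≤ V / Gmin := by
        rw [← hpow]
        exact Real.rpow_le_rpow_of_exponent_le hκ.le hu.2
      rw [le_div_iff₀ hG] at hk
      apply min_eq_left
      apply le_max_of_le_right
      have : Gmin * κ ^ u / ((d : ℝ) + 1) * ((d : ℝ) + 1) = Gmin * κ ^ u :=
        div_mul_cancel₀ _ hdp.ne'
      linarith
    rw [e, intervalIntegral.integral_eq_sub_of_hasDerivAt
      (f := fun u => Gmin * κ ^ u / (((d : ℝ) + 1) * Real.log κ))]
    · simp only [hpow, Real.rpow_zero]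
      field_simp
    · intro u _
      have h := ((Real.hasStrictDerivAt_const_rpow hκ0 u).hasDerivAt.const_mul Gmin).div_const
        (((d : ℝ) + 1) * Real.log κ)
      rw [← mul_assoc, mul_div_mul_right _ _ hlog.ne'] at h
      exact h
    · exact ((continuous_const.mul hcr).div_const _).intervalIntegrable _ _
  linarith
end
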